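/- arXiv:2603.15249 — 4 statements merged into one kernel-verified Lean document; each statement's English description precedes it below -/
import Mathlib

section
/- Consider a semantic joint source-channel coding system with finite alphabets: a source pair (S,X) with joint pmf P_{SX} on 𝒮×𝒳, a channel given by transition probabilities P_{Z|Y₁Y₂} from 𝒴₁×𝒴₂ to 𝒵, reconstruction alphabets 𝒮̂ and 𝒳̂, distortion measures d_s : 𝒮×𝒮̂ → [0,∞) and d_x : 𝒳×𝒳̂ → [0,∞), and distortion thresholds D_s, D_x ≥ 0. Then for every positive integer M, every factorization M = M₁·M₂ into positive integers, every joint input pmf P_{Y₁Y₂} on 𝒴₁×𝒴₂, and every product reconstruction pmf P_{ŜX̂} on 𝒮̂×𝒳̂, there exists an encoder f : 𝒳 → 𝒴₁×𝒴₂ and decoders g_Ŝ : 𝒵 → 𝒮̂, g_X̂ : 𝒵 → 𝒳̂ whose excess-distortion probability ε = P[ d_s(S, g_Ŝ(Z)) > D_s or d_x(X, g_X̂(Z)) > D_x ] satisfies ε ≤ E[exp(−|ı(Y₁;Z) − log M₁|⁺)] + E[(1 − P_X̂(B_{D_x}(X)))^{M₁}] + E[exp(−|ı(Y₂;Z|Y₁)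 − log M₂|⁺)] + E[ T(X) · Σ_{x̂ ∈ B_{D_x}(X)} P_X̂(x̂) · ∫₀¹ (P_Ŝ{ ŝ : π(X, ŝ | x̂) > t })^{M₂} dt ], where the expectations over (S,X,Y₁,Y₂,Z,Ŝ,X̂) are taken with respect to P_{SX} P_{Y₁Y₂} P_{Z|Y₁Y₂} P_{ŜX̂} (with (Y₁,Y₂) independent of (S,X) in the random-coding terms). -/
open Finset Real

section RandomCoding

variable {ι α : Type*} [Fintype ι] [DecidableEq ι] [Fintype α]

theorem exists_le_of_sum_weight_mul_le {w Φ : α → ℝ} {B : ℝ} (hw : ∀ a, 0 ≤ w a)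
    (hw1 : ∑ a, w a = 1) (h : ∑ a, w a * Φ a ≤ B) : ∃ a, Φ a ≤ B := by
  by_contra! hlt
  obtain ⟨a, -, ha⟩ : ∃ a ∈ univ, 0 < w a :=
    exists_lt_of_sum_lt (f := fun _ => (0 : ℝ)) (by simp [hw1])
  have : ∑ a, w a * B < ∑ a, w a * Φ a :=
    sum_lt_sum (fun b _ => mul_le_mul_of_nonneg_left (hlt b).le (hw b))
      ⟨a, mem_univ a, mul_lt_mul_of_pos_left (hlt a) ha⟩
  rw [← sum_mul, hw1, one_mul] at this
  linarith

theorem sum_pi_prod_eq (f : ι → α → ℝ) :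
    ∑ c : ι → α, ∏ i, f i (c i) = ∏ i, ∑ a, f i a := by
  rw [Finset.prod_univ_sum, Fintype.piFinset_univ]

variable {p : α → ℝ}

theorem sum_pi_prod_eq_one (hp1 : ∑ a, p a = 1) : ∑ c : ι → α, ∏ k, p (c k) = 1 := by
  rw [sum_pi_prod_eq (fun _ => p)]
  simp [hp1]

theorem sum_pi_prod_mul_eval (hp1 : ∑ a, p a = 1) (i : ι) (G : α → ℝ) :
    ∑ c : ι → α, (∏ k, p (c k)) * G (c i) = ∑ a, p a * G a := by
  have h := sum_pi_prod_eq (fun l b => p b * if l = i then G b else 1)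
  rw [prod_eq_single i (fun l _ hl => by simp [hl, hp1]) (by simp)] at h
  simp only [prod_mul_distrib, prod_ite_eq', mem_univ, if_true] at h
  simpa using h

theorem sum_pi_prod_mul_eval_mul_eval (hp1 : ∑ a, p a = 1) {i k : ι} (hik : i ≠ k)
    (G H : α → ℝ) :
    ∑ c : ι → α, (∏ l, p (c l)) * (G (c i) * H (c k))
      = (∑ a, p a * G a) * ∑ a, p a * H a := by
  have h := sum_pi_prod_eq
    (fun l b => p b * ((if l = i then G b else 1) * if l = k then H b else 1))
  rw [prod_eq_mul i k hik (fun l _ hl => by simp [hl.1, hl.2, hp1]) (by simp) (by simp)] at h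
  simp only [prod_mul_distrib, prod_ite_eq', mem_univ, if_true] at h
  simpa [hik, hik.symm] using h

/-- The random-coding union bound for an i.i.d. codebook, conditioned on the `i`-th codeword. -/
theorem sum_pi_prod_mul_min_le (hp : ∀ a, 0 ≤ p a) (hp1 : ∑ a, p a = 1) (i : ι)
    {F : α → ℝ} (hF : ∀ a, 0 ≤ F a) {h : α → α → ℝ} (hh : ∀ a b, 0 ≤ h a b) :
    ∑ c : ι → α, (∏ k, p (c k)) * (F (c i) * min 1 (∑ k with k ≠ i, h (c i) (c k)))
      ≤ ∑ a, p a * (F a * min 1 (Fintype.card ι * ∑ b, p b * h a b)) := by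
  classical
  have hP : ∀ c : ι → α, 0 ≤ ∏ k, p (c k) := fun c => prod_nonneg fun _ _ => hp _
  have hsplit : ∀ c : ι → α,
      (∏ k, p (c k)) * (F (c i) * min 1 (∑ k with k ≠ i, h (c i) (c k)))
        = ∑ a, F a * ((∏ k, p (c k)) *
            ((if c i = a then 1 else 0) * min 1 (∑ k with k ≠ i, h a (c k)))) := by
    intro c
    rw [sum_eq_single (c i) (fun a _ ha => by simp [ha.symm]) (by simp)]
    simp only [if_true]
    ring
  simp_rw [hsplit]
  rw [sum_comm]
  refine sum_le_sum fun a _ => ?_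
  rw [← mul_sum, mul_left_comm]
  refine mul_le_mul_of_nonneg_left ?_ (hF a)
  rw [mul_min_of_nonneg _ _ (hp a), mul_one]
  have hδ : ∑ b, p b * (if b = a then (1 : ℝ) else 0) = p a := by simp
  have hδ0 : ∀ c : ι → α, (0 : ℝ) ≤ if c i = a then 1 else 0 := fun c => by split_ifs <;> simp
  refine le_min ?_ ?_
  · refine le_trans (sum_le_sum fun c _ => mul_le_mul_of_nonneg_left
      (mul_le_of_le_one_right (hδ0 c) (min_le_left _ _)) (hP c)) ?_
    rw [sum_pi_prod_mul_eval hp1 i (fun b => if b = a then (1 : ℝ) else 0), hδ]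
  · refine le_trans (sum_le_sum fun c _ => mul_le_mul_of_nonneg_left
      (mul_le_mul_of_nonneg_left (min_le_right _ _) (hδ0 c)) (hP c)) ?_
    simp_rw [mul_sum]
    rw [sum_comm]
    refine (sum_le_card_nsmul _ _ (p a * ∑ b, p b * h a b) fun k hk => ?_).trans ?_
    · rw [sum_pi_prod_mul_eval_mul_eval hp1 (mem_filter.1 hk).2.symm
        (fun b => if b = a then (1 : ℝ) else 0) (h a), hδ]
    · have h0 : 0 ≤ p a * ∑ b, p b * h a b :=
        mul_nonneg (hp a) (sum_nonneg fun b _ => mul_nonneg (hp b) (hh a b))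
      have hcard : ((#{k : ι | k ≠ i} : ℕ) : ℝ) ≤ Fintype.card ι :=
        Nat.cast_le.2 (card_le_univ _)
      rw [nsmul_eq_mul]
      calc _ ≤ (Fintype.card ι : ℝ) * (p a * ∑ b, p b * h a b) :=
            mul_le_mul_of_nonneg_right hcard h0
        _ = _ := by rw [mul_left_comm, mul_sum]; simp [mul_sum]

theorem min_one_mul_sum_le_exp (hp : ∀ a, 0 ≤ p a) {V : α → ℝ} (hV : ∀ a, 0 ≤ V a)
    {v P : ℝ} (hv : 0 < v) (hP : 0 < P) (hPV : ∑ a, p a * V a = P) {N : ℕ} (hN : 0 < N) :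
    min 1 ((N : ℝ) * ∑ a, p a * (if v ≤ V a then 1 else 0))
      ≤ exp (-(max (log (v / P) - log N) 0)) := by
  have hN' : (0 : ℝ) < N := Nat.cast_pos.2 hN
  have hmarkov : ∑ a, p a * (if v ≤ V a then (1 : ℝ) else 0) ≤ P / v := by
    rw [← hPV, sum_div]
    refine sum_le_sum fun a _ => ?_
    rw [mul_div_assoc]
    refine mul_le_mul_of_nonneg_left ?_ (hp a)
    split_ifs with h
    · exact (one_le_div hv).2 h
    · exact div_nonneg (hV a) hv.le
  rcases max_cases (log (v / P) - log N) 0 with ⟨h, -⟩ | ⟨h, -⟩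
  · rw [h]
    refine (min_le_right _ _).trans ((mul_le_mul_of_nonneg_left hmarkov hN'.le).trans_eq ?_)
    rw [neg_sub, exp_sub, exp_log hN', exp_log (div_pos hv hP)]
    field_simp
  · rw [h]
    simp

end RandomCoding

section Channel

variable {X Y₁ Y₂ Z : Type*}

/-- The pmf of a superposition code cloud: a center together with `N` conditionally i.i.d.
satellites. -/
noncomputable def cloudPMF (r : Y₁ → ℝ) (κ : Y₁ → Y₂ → ℝ) (N : ℕ)
    (a : Y₁ × (Fin N → Y₂)) : ℝ :=
  r a.1 * ∏ j, κ a.1 (a.2 j)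

variable {r : Y₁ → ℝ} {κ : Y₁ → Y₂ → ℝ} {N : ℕ}

theorem cloudPMF_nonneg (hr : ∀ y, 0 ≤ r y) (hκ : ∀ y y', 0 ≤ κ y y')
    (a : Y₁ × (Fin N → Y₂)) : 0 ≤ cloudPMF r κ N a :=
  mul_nonneg (hr _) (prod_nonneg fun _ _ => hκ _ _)

variable [Fintype X] [Fintype Y₁] [Fintype Y₂] [Fintype Z]

theorem sum_cloudPMF_mul (G : Y₁ → (Fin N → Y₂) → ℝ) :
    ∑ a, cloudPMF r κ N a * G a.1 a.2
      = ∑ y₁, r y₁ * ∑ y₂ : Fin N → Y₂, (∏ j, κ y₁ (y₂ j)) * G y₁ y₂ := by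
  simp only [Fintype.sum_prod_type, cloudPMF, mul_sum, mul_assoc]

theorem sum_cloudPMF_mul_center (hκ1 : ∀ y, ∑ y', κ y y' = 1) (G : Y₁ → ℝ) :
    ∑ a, cloudPMF r κ N a * G a.1 = ∑ y₁, r y₁ * G y₁ := by
  rw [sum_cloudPMF_mul (fun y _ => G y)]
  refine sum_congr rfl fun y _ => ?_
  rw [← sum_mul, sum_pi_prod_eq_one (hκ1 y), one_mul]

theorem sum_cloudPMF_mul_satellite (hκ1 : ∀ y, ∑ y', κ y y' = 1) (j : Fin N)
    (G : Y₁ → Y₂ → ℝ) :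
    ∑ a, cloudPMF r κ N a * G a.1 (a.2 j) = ∑ y₁, r y₁ * ∑ y₂, κ y₁ y₂ * G y₁ y₂ := by
  rw [sum_cloudPMF_mul (fun y y' => G y (y' j))]
  exact sum_congr rfl fun y _ => by rw [sum_pi_prod_mul_eval (hκ1 y) j]

theorem sum_cloudPMF (hr1 : ∑ y, r y = 1) (hκ1 : ∀ y, ∑ y', κ y y' = 1) :
    ∑ a, cloudPMF r κ N a = 1 := by
  simpa [hr1] using sum_cloudPMF_mul_center (r := r) (N := N) hκ1 (fun _ => 1)

/-- A superposition code with successive decoding. -/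
theorem exists_superposition_code
    {pX : X → ℝ} (hpX : ∀ x, 0 ≤ pX x) (hpX1 : ∑ x, pX x = 1)
    {ch : Y₁ → Y₂ → Z → ℝ} (hch : ∀ y₁ y₂ z, 0 ≤ ch y₁ y₂ z)
    (hr : ∀ y, 0 ≤ r y) (hr1 : ∑ y, r y = 1)
    (hκ : ∀ y y', 0 ≤ κ y y') (hκ1 : ∀ y, ∑ y', κ y y' = 1)
    {V : Y₁ → Z → ℝ} (hV : ∀ y z, V y z = ∑ y', κ y y' * ch y y' z)
    {W : Z → ℝ} (hW : ∀ z, W z = ∑ y, r y * V y z)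
    {M₁ M₂ : ℕ} (hM₁ : 0 < M₁) (hM₂ : 0 < M₂) (m : X → Fin M₁ × Fin M₂) :
    ∃ (c : Fin M₁ → Y₁ × (Fin M₂ → Y₂)) (g : Z → Fin M₁ × Fin M₂),
      (∑ x, pX x * ∑ z, ch (c (m x).1).1 ((c (m x).1).2 (m x).2) z *
          (if g z = m x then 0 else 1))
        ≤ (∑ y₁, ∑ y₂, ∑ z, r y₁ * κ y₁ y₂ * ch y₁ y₂ z *
              exp (-(max (log (V y₁ z / W z) - log M₁) 0)))
          + ∑ y₁, ∑ y₂, ∑ z, r y₁ * κ y₁ y₂ * ch y₁ y₂ z *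
              exp (-(max (log (ch y₁ y₂ z / V y₁ z) - log M₂) 0)) := by
  have : Nonempty (Fin M₁) := ⟨⟨0, hM₁⟩⟩
  have : Nonempty (Fin M₂) := ⟨⟨0, hM₂⟩⟩
  set A := ∑ y₁, ∑ y₂, ∑ z, r y₁ * κ y₁ y₂ * ch y₁ y₂ z *
              exp (-(max (log (V y₁ z / W z) - log M₁) 0)) with hA
  set B := ∑ y₁, ∑ y₂, ∑ z, r y₁ * κ y₁ y₂ * ch y₁ y₂ z *
              exp (-(max (log (ch y₁ y₂ z / V y₁ z) - log M₂) 0)) with hB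
  have hV0 : ∀ y z, 0 ≤ V y z := fun y z => by
    rw [hV]; exact sum_nonneg fun y' _ => mul_nonneg (hκ _ _) (hch _ _ _)
  let q := cloudPMF r κ M₂
  have hq : ∀ a, 0 ≤ q a := cloudPMF_nonneg hr hκ
  have hq1 : ∑ a, q a = 1 := sum_cloudPMF hr1 hκ1
  have hqpos : ∀ a, 0 < q a → 0 < r a.1 ∧ ∀ j, 0 < κ a.1 (a.2 j) := by
    intro a ha
    refine ⟨(hr _).lt_of_ne' fun h => ?_, fun j => (hκ _ _).lt_of_ne' fun h => ?_⟩
    · simp [q, cloudPMF, h] at ha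
    · have h0 : ∏ l, κ a.1 (a.2 l) = 0 := prod_eq_zero (mem_univ j) h
      simp [q, cloudPMF, h0] at ha
  let e₁ : (Fin M₁ → Y₁ × (Fin M₂ → Y₂)) → Fin M₁ → Z → ℝ := fun c i z =>
    min 1 (∑ k with k ≠ i, if V (c i).1 z ≤ V (c k).1 z then 1 else 0)
  let e₂ : Y₁ → (Fin M₂ → Y₂) → Fin M₂ → Z → ℝ := fun y₁ y j z =>
    min 1 (∑ l with l ≠ j, if ch y₁ (y j) z ≤ ch y₁ (y l) z then 1 else 0)
  have hposV : ∀ y₁ y₂ z, 0 < κ y₁ y₂ → 0 < ch y₁ y₂ z → 0 < V y₁ z := by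
    intro y₁ y₂ z h1 h2
    rw [hV]
    exact (mul_pos h1 h2).trans_le (single_le_sum (f := fun y' => κ y₁ y' * ch y₁ y' z)
      (fun y' _ => mul_nonneg (hκ _ _) (hch _ _ _)) (mem_univ y₂))
  have hposW : ∀ y₁ z, 0 < r y₁ → 0 < V y₁ z → 0 < W z := by
    intro y₁ z h1 h2
    rw [hW]
    exact (mul_pos h1 h2).trans_le (single_le_sum (f := fun y => r y * V y z)
      (fun y _ => mul_nonneg (hr _) (hV0 _ _)) (mem_univ y₁))
  have hE₁ : ∀ i j, ∑ c : Fin M₁ → Y₁ × (Fin M₂ → Y₂), (∏ k, q (c k)) *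
      ∑ z, ch (c i).1 ((c i).2 j) z * e₁ c i z ≤ A := by
    intro i j
    simp_rw [mul_sum]
    rw [sum_comm]
    calc _ ≤ ∑ z, ∑ a, q a * (ch a.1 (a.2 j) z *
              exp (-(max (log (V a.1 z / W z) - log M₁) 0))) := by
            refine sum_le_sum fun z _ => ?_
            refine (sum_pi_prod_mul_min_le hq hq1 i (F := fun a => ch a.1 (a.2 j) z)
              (h := fun a b => if V a.1 z ≤ V b.1 z then 1 else 0) (fun a => hch _ _ _)
              (fun a b => by split_ifs <;> simp)).trans ?_
            refine sum_le_sum fun a _ => ?_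
            rcases (hq a).eq_or_lt with h0 | h0
            · rw [← h0]; simp
            rcases (hch a.1 (a.2 j) z).eq_or_lt with h1 | h1
            · rw [← h1]; simp
            refine mul_le_mul_of_nonneg_left (mul_le_mul_of_nonneg_left ?_ h1.le) h0.le
            obtain ⟨hr0, hκ0⟩ := hqpos a h0
            have hVa := hposV a.1 (a.2 j) z (hκ0 j) h1
            rw [Fintype.card_fin]
            exact min_one_mul_sum_le_exp hq (V := fun b => V b.1 z) (fun b => hV0 _ _) hVa
              (hposW a.1 z hr0 hVa)
              ((sum_cloudPMF_mul_center hκ1 (fun y => V y z)).trans (hW z).symm) hM₁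
      _ = ∑ a, q a * ∑ z, (ch a.1 (a.2 j) z *
              exp (-(max (log (V a.1 z / W z) - log M₁) 0))) := by
            rw [sum_comm]; simp_rw [mul_sum]
      _ = A := by
            rw [sum_cloudPMF_mul_satellite hκ1 j (fun y₁ y₂ => ∑ z, (ch y₁ y₂ z *
              exp (-(max (log (V y₁ z / W z) - log M₁) 0))))]
            simp only [hA, mul_sum, mul_assoc]
  have hE₂ : ∀ i j, ∑ c : Fin M₁ → Y₁ × (Fin M₂ → Y₂), (∏ k, q (c k)) *
      ∑ z, ch (c i).1 ((c i).2 j) z * e₂ (c i).1 (c i).2 j z ≤ B := by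
    intro i j
    rw [sum_pi_prod_mul_eval hq1 i
        (fun a => ∑ z, ch a.1 (a.2 j) z * e₂ a.1 a.2 j z),
      sum_cloudPMF_mul (fun y₁ y => ∑ z, ch y₁ (y j) z * e₂ y₁ y j z)]
    have hB' : B = ∑ y₁, r y₁ * ∑ z, ∑ y₂, κ y₁ y₂ * (ch y₁ y₂ z *
              exp (-(max (log (ch y₁ y₂ z / V y₁ z) - log M₂) 0))) := by
      refine sum_congr rfl fun y₁ _ => ?_
      rw [sum_comm]
      simp only [mul_sum, mul_assoc]
    rw [hB']
    refine sum_le_sum fun y₁ _ => mul_le_mul_of_nonneg_left ?_ (hr y₁)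
    simp_rw [mul_sum]
    rw [sum_comm]
    refine sum_le_sum fun z _ => ?_
    refine (sum_pi_prod_mul_min_le (hκ y₁) (hκ1 y₁) j (F := fun y₂ => ch y₁ y₂ z)
      (h := fun a b => if ch y₁ a z ≤ ch y₁ b z then 1 else 0) (fun a => hch _ _ _)
      (fun a b => by split_ifs <;> simp)).trans ?_
    refine sum_le_sum fun y₂ _ => ?_
    rcases (hκ y₁ y₂).eq_or_lt with h0 | h0
    · rw [← h0]; simp
    rcases (hch y₁ y₂ z).eq_or_lt with h1 | h1
    · rw [← h1]; simp
    refine mul_le_mul_of_nonneg_left (mul_le_mul_of_nonneg_left ?_ h1.le) h0.le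
    rw [Fintype.card_fin]
    exact min_one_mul_sum_le_exp (hκ y₁) (V := fun b => ch y₁ b z) (fun b => hch _ _ _) h1
      (hposV y₁ y₂ z h0 h1) (hV y₁ z).symm hM₂
  have hP : ∀ c : Fin M₁ → Y₁ × (Fin M₂ → Y₂), 0 ≤ ∏ k, q (c k) :=
    fun c => prod_nonneg fun _ _ => hq _
  obtain ⟨c, hc⟩ := exists_le_of_sum_weight_mul_le hP (sum_pi_prod_eq_one hq1)
    (Φ := fun c => ∑ x, pX x *
      (∑ z, ch (c (m x).1).1 ((c (m x).1).2 (m x).2) z * e₁ c (m x).1 z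
        + ∑ z, ch (c (m x).1).1 ((c (m x).1).2 (m x).2) z *
            e₂ (c (m x).1).1 (c (m x).1).2 (m x).2 z)) (B := A + B) (by
      simp_rw [mul_sum (s := (univ : Finset X))]
      rw [sum_comm]
      calc _ ≤ ∑ x, pX x * (A + B) := by
            refine sum_le_sum fun x _ => ?_
            simp_rw [mul_left_comm _ (pX x), mul_add (∏ k, q _)]
            rw [← mul_sum, sum_add_distrib]
            exact mul_le_mul_of_nonneg_left (add_le_add (hE₁ _ _) (hE₂ _ _)) (hpX x)
        _ = A + B := by rw [← sum_mul, hpX1, one_mul])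
  choose i₀ hi₀ using fun z => Finite.exists_max (fun i => V (c i).1 z)
  choose j₀ hj₀ using fun z => Finite.exists_max (fun j => ch (c (i₀ z)).1 ((c (i₀ z)).2 j) z)
  refine ⟨c, fun z => (i₀ z, j₀ z), le_trans ?_ hc⟩
  refine sum_le_sum fun x _ => mul_le_mul_of_nonneg_left ?_ (hpX x)
  rw [← sum_add_distrib]
  refine sum_le_sum fun z _ => ?_
  rw [← mul_add]
  refine mul_le_mul_of_nonneg_left ?_ (hch _ _ _)
  have he₁ : 0 ≤ e₁ c (m x).1 z :=
    le_min zero_le_one (sum_nonneg fun _ _ => by split_ifs <;> simp)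
  have he₂ : 0 ≤ e₂ (c (m x).1).1 (c (m x).1).2 (m x).2 z :=
    le_min zero_le_one (sum_nonneg fun _ _ => by split_ifs <;> simp)
  split_ifs with hdec
  · exact add_nonneg he₁ he₂
  by_cases hi : i₀ z = (m x).1
  · have hj : j₀ z ≠ (m x).2 := fun hj => hdec (Prod.ext hi hj)
    refine le_add_of_nonneg_of_le he₁ (le_min le_rfl ?_)
    refine le_trans ?_ (single_le_sum (fun _ _ => by split_ifs <;> simp)
      (mem_filter.2 ⟨mem_univ _, hj⟩))
    have := hj₀ z (m x).2
    rw [hi] at this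
    rw [if_pos this]
  · refine le_add_of_le_of_nonneg (le_min le_rfl ?_) he₂
    refine le_trans ?_ (single_le_sum (fun _ _ => by split_ifs <;> simp)
      (mem_filter.2 ⟨mem_univ _, hi⟩))
    rw [if_pos (hi₀ z (m x).1)]

end Channel

section Source

variable {Sh Xh : Type*} [Fintype Sh] [Fintype Xh]

theorem integral_ite_lt_eq {a : ℝ} (h0 : 0 ≤ a) (h1 : a ≤ 1) :
    IntervalIntegrable (fun t => if t < a then (1 : ℝ) else 0) MeasureTheory.volume 0 1 ∧
      ∫ t in (0 : ℝ)..1, (if t < a then (1 : ℝ) else 0) = a := by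
  have hind : (fun t => if t < a then (1 : ℝ) else 0) = (Set.Iio a).indicator fun _ => 1 := by
    ext t; simp [Set.indicator_apply]
  have hint : MeasureTheory.IntegrableOn ((Set.Iio a).indicator fun _ => (1 : ℝ))
      (Set.Ioc (0 : ℝ) 1) :=
    (MeasureTheory.integrableOn_const (by simp)).indicator measurableSet_Iio
  rw [hind]
  refine ⟨(intervalIntegrable_iff_integrableOn_Ioc_of_le zero_le_one).2 hint, ?_⟩
  rw [intervalIntegral.integral_of_le zero_le_one,
    MeasureTheory.setIntegral_indicator measurableSet_Iio]
  have hset : (Set.Ioc (0 : ℝ) 1 ∩ Set.Iio a : Set ℝ)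
      =ᵐ[MeasureTheory.volume] (Set.Ioc 0 a : Set ℝ) := by
    have : Set.Ioc (0 : ℝ) 1 ∩ Set.Iio a = Set.Ioo 0 a := by
      ext t
      simp only [Set.mem_inter_iff, Set.mem_Ioc, Set.mem_Iio, Set.mem_Ioo]
      exact ⟨fun h => ⟨h.1.1, h.2⟩, fun h => ⟨⟨h.1, h.2.le.trans h1⟩, h.2⟩⟩
    rw [this]
    exact MeasureTheory.Ioo_ae_eq_Ioc
  rw [MeasureTheory.setIntegral_congr_set hset]
  simp [h0]

/-- The mean of the minimum of `N` i.i.d. `[0, 1]`-valued random variables, as the integral of its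
tail. -/
theorem sum_pi_prod_mul_inf_eq_integral {α : Type*} [Fintype α] (p : α → ℝ) {e : α → ℝ}
    (he0 : ∀ a, 0 ≤ e a) (he1 : ∀ a, e a ≤ 1) {N : ℕ} {μ : (Fin N → α) → ℝ}
    (hμ : ∀ y, ∃ j, μ y = e (y j)) (hμle : ∀ y j, μ y ≤ e (y j)) :
    ∑ y : Fin N → α, (∏ j, p (y j)) * μ y
      = ∫ t in (0 : ℝ)..1, (∑ a with t < e a, p a) ^ N := by
  have hpow : ∀ t : ℝ, (∑ a with t < e a, p a) ^ N
      = ∑ y : Fin N → α, (∏ j, p (y j)) * if t < μ y then (1 : ℝ) else 0 := by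
    intro t
    have h := sum_pi_prod_eq (ι := Fin N) (fun _ a => p a * if t < e a then 1 else 0)
    rw [prod_const, card_univ, Fintype.card_fin] at h
    rw [sum_filter]
    simp only [mul_ite, mul_one, mul_zero] at h ⊢
    rw [← h]
    refine sum_congr rfl fun y _ => ?_
    obtain ⟨j₀, hj₀⟩ := hμ y
    split_ifs with hy
    · exact prod_congr rfl fun j _ => if_pos (hy.trans_le (hμle y j))
    · exact prod_eq_zero (mem_univ j₀) (if_neg (hj₀ ▸ hy))
  have hμ01 : ∀ y, 0 ≤ μ y ∧ μ y ≤ 1 := fun y => by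
    obtain ⟨j, hj⟩ := hμ y
    exact hj ▸ ⟨he0 _, he1 _⟩
  simp_rw [hpow]
  rw [intervalIntegral.integral_finsetSum fun y _ =>
    (integral_ite_lt_eq (hμ01 y).1 (hμ01 y).2).1.const_mul _]
  refine sum_congr rfl fun y _ => ?_
  rw [intervalIntegral.integral_const_mul, (integral_ite_lt_eq (hμ01 y).1 (hμ01 y).2).2]

theorem sum_mul_ite_not {α : Type*} [Fintype α] {p : α → ℝ} (hp1 : ∑ a, p a = 1)
    (b : α → Prop) [DecidablePred b] :
    ∑ a, p a * (if b a then (0 : ℝ) else 1) = 1 - ∑ a with b a, p a := by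
  rw [eq_sub_iff_add_eq, sum_filter, ← sum_add_distrib]
  exact (sum_congr rfl fun a _ => by split_ifs <;> simp).trans hp1

/-- The probability weight of the first hit of a set happening at time `i`, jointly with a function
of the hitting value. -/
theorem sum_pi_prod_mul_first_hit {α : Type*} [Fintype α] {p : α → ℝ} (hp1 : ∑ a, p a = 1)
    (b : α → Prop) [DecidablePred b] (G : α → ℝ) {N : ℕ} (i : Fin N) :
    ∑ c : Fin N → α, (∏ k, p (c k)) *
        ((if ∀ k < i, ¬ b (c k) then 1 else 0) * if b (c i) then G (c i) else 0)
      = (1 - ∑ a with b a, p a) ^ (i : ℕ) * ∑ a with b a, p a * G a := by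
  have h := sum_pi_prod_eq (ι := Fin N) (fun k a => p a *
    ((if k < i then (if b a then 0 else 1) else 1) *
      if k = i then (if b a then G a else 0) else 1))
  have hfac : ∀ k : Fin N, ∑ a, p a * ((if k < i then (if b a then (0 : ℝ) else 1) else 1) *
      if k = i then (if b a then G a else 0) else 1)
      = (if k < i then 1 - ∑ a with b a, p a else 1) *
        if k = i then ∑ a with b a, p a * G a else 1 := by
    intro k
    rcases lt_trichotomy k i with hk | rfl | hk
    · simp only [hk, hk.ne, if_true, if_false, mul_one, sum_mul_ite_not hp1]
    · simp [sum_filter]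
    · simp [hk.ne', hk.not_gt, hp1]
  simp_rw [hfac] at h
  rw [prod_mul_distrib, prod_ite_eq' univ i, if_pos (mem_univ i), prod_ite, prod_const,
    prod_const_one, mul_one] at h
  have hcard : #{k : Fin N | k < i} = (i : ℕ) := by
    rw [show ({k : Fin N | k < i} : Finset (Fin N)) = Iio i by ext; simp, Fin.card_Iio]
  rw [hcard] at h
  rw [← h]
  refine sum_congr rfl fun c _ => ?_
  rw [prod_mul_distrib, prod_mul_distrib, prod_ite_eq' univ i, if_pos (mem_univ i)]
  congr 2
  split_ifs with hc
  · refine (prod_eq_one fun k _ => ?_).symm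
    split_ifs with h1 h2
    · exact absurd h2 (hc k h1)
    all_goals rfl
  · push Not at hc
    obtain ⟨k, hk, hbk⟩ := hc
    exact (prod_eq_zero (mem_univ k) (by simp [hk, hbk])).symm

theorem sum_pi_prod_mul_no_hit {α : Type*} [Fintype α] {p : α → ℝ} (hp1 : ∑ a, p a = 1)
    (b : α → Prop) [DecidablePred b] {N : ℕ} :
    ∑ c : Fin N → α, (∏ k, p (c k)) * (if ∀ k, ¬ b (c k) then 1 else 0)
      = (1 - ∑ a with b a, p a) ^ N := by
  have h := sum_pi_prod_eq (ι := Fin N) (fun _ a => p a * if b a then 0 else 1)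
  simp_rw [sum_mul_ite_not hp1] at h
  rw [prod_const, card_univ, Fintype.card_fin] at h
  rw [← h]
  refine sum_congr rfl fun c _ => ?_
  rw [prod_mul_distrib]
  congr 1
  split_ifs with hc
  · exact (prod_eq_one fun k _ => by simp [hc k]).symm
  · push Not at hc
    obtain ⟨k, hbk⟩ := hc
    exact (prod_eq_zero (mem_univ k) (by simp [hbk])).symm

/-- A two-layer source code. `e x s` is the excess probability of the reconstruction `s` given the
source letter `x`, and `b x` is the set of admissible first-layer reconstructions. -/
theorem exists_layered_source_code {X : Type*} [Fintype X]
    {pX : X → ℝ} (hpX : ∀ x, 0 ≤ pX x)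
    {p : Xh → ℝ} (hp : ∀ a, 0 ≤ p a) (hp1 : ∑ a, p a = 1)
    {p' : Sh → ℝ} (hp' : ∀ a, 0 ≤ p' a) (hpsum' : ∑ a, p' a = 1)
    {e : X → Sh → ℝ} (he0 : ∀ x a, 0 ≤ e x a) (he1 : ∀ x a, e x a ≤ 1)
    (b : X → Xh → Prop) [∀ x, DecidablePred (b x)]
    {M₁ M₂ : ℕ} (hM₁ : 0 < M₁) (hM₂ : 0 < M₂) :
    ∃ (c : Fin M₁ → Xh × (Fin M₂ → Sh)) (m : X → Fin M₁ × Fin M₂),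
      (∑ x, pX x * (if b x (c (m x).1).1 then e x ((c (m x).1).2 (m x).2) else 1))
        ≤ (∑ x, pX x * (1 - ∑ a with b x a, p a) ^ M₁)
          + ∑ x, pX x * ((∑ i ∈ range M₁, (1 - ∑ a with b x a, p a) ^ i) *
              ∑ a with b x a, p a *
                ∫ t in (0 : ℝ)..1, (∑ s with t < e x s, p' s) ^ M₂) := by
  have : Nonempty (Fin M₁) := ⟨⟨0, hM₁⟩⟩
  have : Nonempty (Fin M₂) := ⟨⟨0, hM₂⟩⟩
  choose j₀ hj₀ using fun (x : X) (y : Fin M₂ → Sh) => Finite.exists_min (fun j => e x (y j))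
  let μ : X → (Fin M₂ → Sh) → ℝ := fun x y => e x (y (j₀ x y))
  let q := cloudPMF p (fun _ => p') M₂
  have hq : ∀ a, 0 ≤ q a := cloudPMF_nonneg hp fun _ => hp'
  have hq1 : ∑ a, q a = 1 := sum_cloudPMF hp1 fun _ => hpsum'
  have hqb : ∀ x, ∑ a with b x a.1, q a = ∑ a with b x a, p a := by
    intro x
    have := sum_cloudPMF_mul_center (r := p) (κ := fun _ => p') (N := M₂) (fun _ => hpsum')
      (fun y => if b x y then 1 else 0)
    simpa [sum_filter] using this
  have hqμ : ∀ x, ∑ a with b x a.1, q a * μ x a.2 = ∑ a with b x a, p a *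
      ∫ t in (0 : ℝ)..1, (∑ s with t < e x s, p' s) ^ M₂ := by
    intro x
    have := sum_cloudPMF_mul (r := p) (κ := fun _ => p') (N := M₂)
      (fun y y' => (if b x y then 1 else 0) * μ x y')
    simp_rw [mul_left_comm _ (ite _ _ _), ← mul_sum] at this
    rw [← sum_pi_prod_mul_inf_eq_integral p' (he0 x) (he1 x) (fun y => ⟨_, rfl⟩) (hj₀ x)]
    simpa [sum_filter] using this
  let Φ : (Fin M₁ → Xh × (Fin M₂ → Sh)) → X → ℝ := fun c x =>
    (if ∀ k, ¬ b x (c k).1 then 1 else 0) + ∑ i, (if ∀ k < i, ¬ b x (c k).1 then 1 else 0) *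
      if b x (c i).1 then μ x (c i).2 else 0
  have hE : ∀ x, ∑ c, (∏ k, q (c k)) * Φ c x = (1 - ∑ a with b x a, p a) ^ M₁
      + (∑ i ∈ range M₁, (1 - ∑ a with b x a, p a) ^ i) *
          ∑ a with b x a, p a * ∫ t in (0 : ℝ)..1, (∑ s with t < e x s, p' s) ^ M₂ := by
    intro x
    simp_rw [Φ, mul_add, mul_sum (s := (univ : Finset (Fin M₁)))]
    rw [sum_add_distrib, sum_pi_prod_mul_no_hit hq1 (fun a => b x a.1), hqb, sum_comm]
    simp_rw [sum_pi_prod_mul_first_hit hq1 (fun a => b x a.1) (fun a => μ x a.2), hqb, hqμ]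
    rw [← sum_mul, Fin.sum_univ_eq_sum_range fun i => (1 - ∑ a with b x a, p a) ^ i]
  obtain ⟨c, hc⟩ := exists_le_of_sum_weight_mul_le (w := fun c => ∏ k, q (c k))
    (fun c => prod_nonneg fun _ _ => hq _) (sum_pi_prod_eq_one hq1)
    (Φ := fun c => ∑ x, pX x * Φ c x)
    (B := ∑ x, pX x * ∑ c : Fin M₁ → Xh × (Fin M₂ → Sh), (∏ k, q (c k)) * Φ c x) (le_of_eq (by
      simp_rw [mul_sum, mul_left_comm _ (pX _)]
      rw [sum_comm]))
  simp_rw [hE, mul_add] at hc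
  rw [sum_add_distrib] at hc
  have hfirst : ∀ x, ∃ i, (if b x (c i).1 then μ x (c i).2 else 1) ≤ Φ c x := by
    intro x
    have hnn : ∀ i, (0 : ℝ) ≤ (if ∀ k < i, ¬ b x (c k).1 then 1 else 0) *
        if b x (c i).1 then μ x (c i).2 else 0 := fun i =>
      mul_nonneg (by split_ifs <;> simp) (by split_ifs; exacts [he0 _ _, le_rfl])
    by_cases hx : ∃ k, b x (c k).1
    · obtain ⟨i, hi, hmin⟩ := WellFounded.has_min (wellFounded_lt (α := Fin M₁))
        {k | b x (c k).1} hx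
      refine ⟨i, ?_⟩
      refine le_add_of_nonneg_of_le (by split_ifs <;> simp) ?_
      refine le_trans (le_of_eq ?_) (single_le_sum (fun i _ => hnn i) (mem_univ i))
      have hi' : b x (c i).1 := hi
      rw [if_pos hi', if_pos hi', if_pos (show ∀ k < i, ¬ b x (c k).1 from
        fun k hk hb => hmin k hb hk), one_mul]
    · push Not at hx
      refine ⟨Classical.arbitrary _, ?_⟩
      rw [if_neg (hx _)]
      exact le_add_of_le_of_nonneg (by rw [if_pos hx]) (sum_nonneg fun i _ => hnn i)
  choose i₀ hi₀ using hfirst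
  refine ⟨c, fun x => (i₀ x, j₀ x (c (i₀ x)).2), le_trans ?_ hc⟩
  exact sum_le_sum fun x _ => mul_le_mul_of_nonneg_left (hi₀ x) (hpX x)

end Source

theorem exists_conditional_pmf {Y₁ Y₂ : Type*} [Fintype Y₂] [Nonempty Y₂]
    {pY : Y₁ → Y₂ → ℝ} (hpY : ∀ y₁ y₂, 0 ≤ pY y₁ y₂) :
    ∃ κ : Y₁ → Y₂ → ℝ, (∀ y₁ y₂, 0 ≤ κ y₁ y₂) ∧ (∀ y₁, ∑ y₂, κ y₁ y₂ = 1) ∧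
      ∀ y₁ y₂, pY y₁ y₂ = (∑ y₂, pY y₁ y₂) * κ y₁ y₂ := by
  classical
  obtain ⟨y₀⟩ := ‹Nonempty Y₂›
  have (y₁ : Y₁) : ∃ κ : Y₂ → ℝ, (∀ y₂, 0 ≤ κ y₂) ∧ (∑ y₂, κ y₂ = 1) ∧
      ∀ y₂, pY y₁ y₂ = (∑ y₂, pY y₁ y₂) * κ y₂ := by
    by_cases h : ∑ y₂, pY y₁ y₂ = 0
    · refine ⟨Pi.single y₀ 1, fun y₂ => ?_, by simp, fun y₂ => ?_⟩
      · by_cases hy : y₂ = y₀ <;> simp [hy]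
      · rw [h, zero_mul]
        exact (sum_eq_zero_iff_of_nonneg fun y _ => hpY y₁ y).1 h y₂ (mem_univ _)
    · exact ⟨fun y₂ => pY y₁ y₂ / ∑ y₂, pY y₁ y₂,
        fun y₂ => div_nonneg (hpY _ _) (sum_nonneg fun y _ => hpY _ _),
        by rw [← sum_div, div_self h], fun y₂ => (mul_div_cancel₀ _ h).symm⟩
  choose κ h0 h1 h2 using this
  exact ⟨κ, h0, h1, h2⟩

/-- Achievability bound for semantic joint source-channel coding (Theorem 2 of the
paper): for every `M = M₁ · M₂`, every input pmf `P_{Y₁Y₂}` and every reconstruction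
pmf `P_{ŜX̂}`, there exist an encoder `f : 𝒳 → 𝒴₁ × 𝒴₂` and decoders
`g_Ŝ : 𝒵 → 𝒮̂`, `g_X̂ : 𝒵 → 𝒳̂` whose excess-distortion probability
`ε = P[d_s(S, g_Ŝ(Z)) > D_s ∨ d_x(X, g_X̂(Z)) > D_x]` satisfies
`ε ≤ E[exp (−|ı(Y₁;Z) − log M₁|⁺)] + E[(1 − P_X̂(B_{D_x}(X)))^{M₁}]
   + E[exp (−|ı(Y₂;Z|Y₁) − log M₂|⁺)]
   + E[T(X) · Σ_{x̂ ∈ B_{D_x}(X)} P_X̂(x̂) ∫₀¹ (P_Ŝ{ŝ : π(X,ŝ|x̂) > t})^{M₂} dt]`. -/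
theorem semantic_jscc_achievability
    {S X Y₁ Y₂ Z Sh Xh : Type*}
    [Fintype S] [Fintype X] [Fintype Y₁] [Fintype Y₂] [Fintype Z]
    [Fintype Sh] [Fintype Xh]
    (pSX : S → X → ℝ) (hpSX : ∀ s x, 0 ≤ pSX s x) (hpSX1 : ∑ s, ∑ x, pSX s x = 1)
    (ch : Y₁ → Y₂ → Z → ℝ) (hch : ∀ y₁ y₂ z, 0 ≤ ch y₁ y₂ z)
    (hch1 : ∀ y₁ y₂, ∑ z, ch y₁ y₂ z = 1)
    (ds : S → Sh → ℝ) (hds : ∀ s sh, 0 ≤ ds s sh)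
    (dx : X → Xh → ℝ) (hdx : ∀ x xh, 0 ≤ dx x xh)
    (Ds Dx : ℝ) (hDs : 0 ≤ Ds) (hDx : 0 ≤ Dx)
    (M M₁ M₂ : ℕ) (hM₁ : 0 < M₁) (hM₂ : 0 < M₂) (hM : M = M₁ * M₂)
    (pY : Y₁ → Y₂ → ℝ) (hpY : ∀ y₁ y₂, 0 ≤ pY y₁ y₂)
    (hpY1 : ∑ y₁, ∑ y₂, pY y₁ y₂ = 1)
    (pR : Sh → Xh → ℝ) (hpR : ∀ sh xh, 0 ≤ pR sh xh)
    (hpR1 : ∑ sh, ∑ xh, pR sh xh = 1) :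
    -- source marginal of `X`
    let pX : X → ℝ := fun x => ∑ s, pSX s x
    -- output marginal `P_Z` and conditional `P_{Z|Y₁}` induced by `P_{Y₁Y₂} P_{Z|Y₁Y₂}`
    let pZ : Z → ℝ := fun z => ∑ y₁, ∑ y₂, pY y₁ y₂ * ch y₁ y₂ z
    let pZ1 : Y₁ → Z → ℝ := fun y₁ z =>
      (∑ y₂, pY y₁ y₂ * ch y₁ y₂ z) / (∑ y₂, pY y₁ y₂)
    -- marginals of the reconstruction pmf `P_{ŜX̂}`
    let pXh : Xh → ℝ := fun xh => ∑ sh, pR sh xh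
    let pSh : Sh → ℝ := fun sh => ∑ xh, pR sh xh
    -- distortion ball `B_{D_x}(x)` and its probability under `P_X̂`
    let ball : X → Finset Xh := fun x => Finset.univ.filter (fun xh => dx x xh ≤ Dx)
    let pball : X → ℝ := fun x => ∑ xh ∈ ball x, pXh xh
    -- conditional excess-distortion probability
    -- `π(x,ŝ|x̂) = P{d_s(S,ŝ) > D_s | X = x, X̂ = x̂}` under `P_{SX} P_{ŜX̂}`
    let pexc : X → Sh → Xh → ℝ := fun x sh _xh =>
      (∑ s ∈ Finset.univ.filter (fun s => Ds < ds s sh), pSX s x) / pX x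
    -- `T(x) = Σ_{i=0}^{M₁−1} (1 − P_X̂(B_{D_x}(x)))^i`
    let T : X → ℝ := fun x => ∑ i ∈ Finset.range M₁, (1 - pball x) ^ i
    ∃ (f : X → Y₁ × Y₂) (gS : Z → Sh) (gX : Z → Xh),
      (∑ s, ∑ x, ∑ z, pSX s x * ch (f x).1 (f x).2 z *
          (if Ds < ds s (gS z) ∨ Dx < dx x (gX z) then 1 else 0))
        ≤ (∑ y₁, ∑ y₂, ∑ z, pY y₁ y₂ * ch y₁ y₂ z *
              Real.exp (-(max (Real.log (pZ1 y₁ z / pZ z) - Real.log (M₁ : ℝ)) 0)))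
          + (∑ x, pX x * (1 - pball x) ^ M₁)
          + (∑ y₁, ∑ y₂, ∑ z, pY y₁ y₂ * ch y₁ y₂ z *
              Real.exp (-(max (Real.log (ch y₁ y₂ z / pZ1 y₁ z)
                - Real.log (M₂ : ℝ)) 0)))
          + (∑ x, pX x * (T x * ∑ xh ∈ ball x, pXh xh *
              ∫ t in (0:ℝ)..1,
                (∑ sh ∈ Finset.univ.filter (fun sh => t < pexc x sh xh), pSh sh) ^ M₂)) := by
  intro pX pZ pZ1 pXh pSh ball pball pexc T
  have hpX : ∀ x, 0 ≤ pX x := fun x => sum_nonneg fun s _ => hpSX s x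
  have hpX1 : ∑ x, pX x = 1 := by rw [← hpSX1, sum_comm]
  have hY₂ : Nonempty Y₂ := by
    by_contra h
    rw [not_nonempty_iff] at h
    simp at hpY1
  obtain ⟨κ, hκ, hκ1, hYκ⟩ := exists_conditional_pmf hpY
  let r : Y₁ → ℝ := fun y₁ => ∑ y₂, pY y₁ y₂
  have hYκ' : ∀ y₁ y₂, pY y₁ y₂ = r y₁ * κ y₁ y₂ := hYκ
  let V : Y₁ → Z → ℝ := fun y₁ z => ∑ y₂, κ y₁ y₂ * ch y₁ y₂ z
  have hrV : ∀ y₁ z, ∑ y₂, pY y₁ y₂ * ch y₁ y₂ z = r y₁ * V y₁ z := fun y₁ z => by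
    simp only [hYκ', V, mul_sum, mul_assoc]
  have hZ1 : ∀ y₁ z, r y₁ ≠ 0 → pZ1 y₁ z = V y₁ z := fun y₁ z h => by
    change (∑ y₂, pY y₁ y₂ * ch y₁ y₂ z) / r y₁ = V y₁ z
    rw [hrV, mul_div_cancel_left₀ _ h]
  have hexc0 : ∀ x sh xh, 0 ≤ pexc x sh xh := fun x sh xh =>
    div_nonneg (sum_nonneg fun s _ => hpSX s x) (hpX x)
  have hexc1 : ∀ x sh xh, pexc x sh xh ≤ 1 := fun x sh xh =>
    div_le_one_of_le₀ (sum_le_sum_of_subset_of_nonneg (filter_subset _ _)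
      fun s _ _ => hpSX s x) (hpX x)
  have hXh : Nonempty Xh := by
    by_contra h
    rw [not_nonempty_iff] at h
    simp at hpR1
  obtain ⟨xh₀⟩ := hXh
  obtain ⟨cs, m, hcs⟩ := exists_layered_source_code hpX (p := pXh) (p' := pSh)
    (fun xh => sum_nonneg fun sh _ => hpR sh xh) (by rw [← hpR1, sum_comm])
    (fun sh => sum_nonneg fun xh _ => hpR sh xh) hpR1
    (e := fun x sh => pexc x sh xh₀) (fun x sh => hexc0 x sh xh₀) (fun x sh => hexc1 x sh xh₀)
    (fun x xh => dx x xh ≤ Dx) hM₁ hM₂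
  obtain ⟨cc, g, hcc⟩ := exists_superposition_code hpX hpX1 hch (r := r)
    (fun y₁ => sum_nonneg fun y₂ _ => hpY y₁ y₂) hpY1 hκ hκ1 (V := V) (fun _ _ => rfl)
    (W := pZ) (fun z => sum_congr rfl fun y₁ _ => hrV y₁ z) hM₁ hM₂ m
  have hA : ∑ y₁, ∑ y₂, ∑ z, pY y₁ y₂ * ch y₁ y₂ z *
        exp (-(max (log (pZ1 y₁ z / pZ z) - log (M₁ : ℝ)) 0))
      = ∑ y₁, ∑ y₂, ∑ z, r y₁ * κ y₁ y₂ * ch y₁ y₂ z *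
        exp (-(max (log (V y₁ z / pZ z) - log (M₁ : ℝ)) 0)) := by
    refine sum_congr rfl fun y₁ _ => sum_congr rfl fun y₂ _ => sum_congr rfl fun z _ => ?_
    rw [hYκ']
    by_cases h : r y₁ = 0
    · simp [h]
    · rw [hZ1 y₁ z h]
  have hB : ∑ y₁, ∑ y₂, ∑ z, pY y₁ y₂ * ch y₁ y₂ z *
        exp (-(max (log (ch y₁ y₂ z / pZ1 y₁ z) - log (M₂ : ℝ)) 0))
      = ∑ y₁, ∑ y₂, ∑ z, r y₁ * κ y₁ y₂ * ch y₁ y₂ z *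
        exp (-(max (log (ch y₁ y₂ z / V y₁ z) - log (M₂ : ℝ)) 0)) := by
    refine sum_congr rfl fun y₁ _ => sum_congr rfl fun y₂ _ => sum_congr rfl fun z _ => ?_
    rw [hYκ']
    by_cases h : r y₁ = 0
    · simp [h]
    · rw [hZ1 y₁ z h]
  have hsource : ∀ x, ∑ s, pSX s x * (if Ds < ds s ((cs (m x).1).2 (m x).2) ∨
        Dx < dx x (cs (m x).1).1 then 1 else 0)
      ≤ pX x * (if dx x (cs (m x).1).1 ≤ Dx
          then pexc x ((cs (m x).1).2 (m x).2) xh₀ else 1) := by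
    intro x
    split_ifs with hb
    · simp only [hb.not_gt, or_false, mul_ite, mul_one, mul_zero]
      rw [← sum_filter]
      change _ ≤ pX x * (_ / pX x)
      rcases (hpX x).eq_or_lt with h | h
      · rw [← h, zero_mul]
        exact (sum_le_sum_of_subset_of_nonneg (filter_subset _ _)
          fun s _ _ => hpSX s x).trans_eq h.symm
      · rw [mul_div_cancel₀ _ h.ne']
    · rw [mul_one]
      exact sum_le_sum fun s _ =>
        mul_le_of_le_one_right (hpSX s x) (by split_ifs <;> simp)
  refine ⟨fun x => ((cc (m x).1).1, (cc (m x).1).2 (m x).2),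
    fun z => (cs (g z).1).2 (g z).2, fun z => (cs (g z).1).1, ?_⟩
  rw [hA, hB]
  suffices h : (∑ s, ∑ x, ∑ z, pSX s x * ch (cc (m x).1).1 ((cc (m x).1).2 (m x).2) z *
        (if Ds < ds s ((cs (g z).1).2 (g z).2) ∨ Dx < dx x (cs (g z).1).1 then 1 else 0))
      ≤ (∑ x, pX x * ∑ z, ch (cc (m x).1).1 ((cc (m x).1).2 (m x).2) z *
          (if g z = m x then 0 else 1))
        + ∑ x, pX x * (if dx x (cs (m x).1).1 ≤ Dx
          then pexc x ((cs (m x).1).2 (m x).2) xh₀ else 1) by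
    refine (h.trans (add_le_add hcc hcs)).trans_eq ?_
    ring
  rw [sum_comm, ← sum_add_distrib]
  refine sum_le_sum fun x _ => ?_
  refine le_trans ?_ (add_le_add_right (hsource x) _)
  rw [sum_mul, ← sum_add_distrib]
  refine sum_le_sum fun s _ => ?_
  simp_rw [mul_assoc, ← mul_sum]
  rw [← mul_add]
  refine mul_le_mul_of_nonneg_left ?_ (hpSX s x)
  have hconst : ∀ u : ℝ, u = ∑ z, ch (cc (m x).1).1 ((cc (m x).1).2 (m x).2) z * u :=
    fun u => by rw [← sum_mul, hch1, one_mul]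
  rw [hconst (ite (_ ∨ Dx < dx x (cs (m x).1).1) 1 0), ← sum_add_distrib]
  refine sum_le_sum fun z _ => ?_
  rw [← mul_add]
  refine mul_le_mul_of_nonneg_left ?_ (hch _ _ _)
  by_cases hg : g z = m x
  · rw [hg, if_pos rfl, zero_add]
  · rw [if_neg hg]
    refine le_add_of_le_of_nonneg ?_ ?_ <;> split_ifs <;> simp
end

section
/- Consider a semantic joint source-channel code over finite alphabets: a source pair (S,X) with joint pmf P_{SX}, a (possibly random) encoder P_{Y|X} from 𝒳 to the finite channel-input alphabet 𝒴, a channel P_{Z|Y} from 𝒴 to the finite alphabet 𝒵, and decoders g_Ŝ : 𝒵 → 𝒮̂, g_X̂ : 𝒵 → 𝒳̂, with distortion measures d_s, d_x and thresholds D_s, D_x. Let ε = P[ d_s(S, g_Ŝ(Z)) > D_s or d_x(X, g_X̂(Z)) > D_x ] be the excess-distortion probability under P_{SX} P_{Y|X} P_{Z|Y}. Then for every auxiliary pmf Q on 𝒵 with Q(z) > 0 for all z, and every real γ, ε ≥ P[ ı_{Y;Q}(Y;Z) ≤ γ ] − e^{γ} · (P_{SXY} ⊗ Q){ (s,x,y,z̄)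 : d_s(s, g_Ŝ(z̄)) ≤ D_s and d_x(x, g_X̂(z̄)) ≤ D_x }, where in the second term z̄ is drawn from Q independently of (S,X,Y). -/
open Finset Real

/-- A bound `γ` on the information density `log (w / q)` is a change of measure from `w` to `q`
at the cost of a factor `e ^ γ`. -/
theorem le_exp_mul_of_log_div_le {w q γ : ℝ} (hw : 0 ≤ w) (hq : 0 < q)
    (h : Real.log (w / q) ≤ γ) : w ≤ Real.exp γ * q := by
  rcases hw.eq_or_lt with rfl | hw
  · positivity
  · rwa [← div_le_iff₀ hq, ← Real.log_le_iff_le_exp (div_pos hw hq)]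

/-- Converse bound for a semantic joint source-channel code: the excess-distortion
probability `ε = P[d_s(S, g_Ŝ(Z)) > D_s ∨ d_x(X, g_X̂(Z)) > D_x]` satisfies, for every
everywhere-positive auxiliary pmf `Q` on `𝒵` and every real `γ`,
`ε ≥ P[ı_{Y;Q}(Y;Z) ≤ γ]
    − e^γ · (P_{SXY} ⊗ Q){(s,x,y,z̄) : d_s(s,g_Ŝ(z̄)) ≤ D_s ∧ d_x(x,g_X̂(z̄)) ≤ D_x}`,
where `ı_{Y;Q}(y;z) = log (P_{Z|Y}(z|y) / Q(z))`. -/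
theorem semantic_jscc_converse
    {S X Y Z Sh Xh : Type*}
    [Fintype S] [Fintype X] [Fintype Y] [Fintype Z] [Fintype Sh] [Fintype Xh]
    (pSX : S → X → ℝ) (hpSX : ∀ s x, 0 ≤ pSX s x) (hpSX1 : ∑ s, ∑ x, pSX s x = 1)
    (enc : X → Y → ℝ) (henc : ∀ x y, 0 ≤ enc x y) (henc1 : ∀ x, ∑ y, enc x y = 1)
    (ch : Y → Z → ℝ) (hch : ∀ y z, 0 ≤ ch y z) (hch1 : ∀ y, ∑ z, ch y z = 1)
    (gS : Z → Sh) (gX : Z → Xh)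
    (ds : S → Sh → ℝ) (hds : ∀ s sh, 0 ≤ ds s sh)
    (dx : X → Xh → ℝ) (hdx : ∀ x xh, 0 ≤ dx x xh)
    (Ds Dx : ℝ) (hDs : 0 ≤ Ds) (hDx : 0 ≤ Dx)
    (Q : Z → ℝ) (hQ : ∀ z, 0 < Q z) (hQ1 : ∑ z, Q z = 1)
    (γ : ℝ) :
    (∑ s, ∑ x, ∑ y, ∑ z, pSX s x * enc x y * ch y z *
        (if Ds < ds s (gS z) ∨ Dx < dx x (gX z) then 1 else 0))
      ≥ (∑ s, ∑ x, ∑ y, ∑ z, pSX s x * enc x y * ch y z *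
            (if Real.log (ch y z / Q z) ≤ γ then 1 else 0))
        - Real.exp γ *
          (∑ s, ∑ x, ∑ y, ∑ z, pSX s x * enc x y * Q z *
            (if ds s (gS z) ≤ Ds ∧ dx x (gX z) ≤ Dx then 1 else 0)) := by
  rw [ge_iff_le, sub_le_iff_le_add]
  simp only [Finset.mul_sum, ← Finset.sum_add_distrib]
  refine Finset.sum_le_sum fun s _ => Finset.sum_le_sum fun x _ =>
    Finset.sum_le_sum fun y _ => Finset.sum_le_sum fun z _ => ?_
  have hp : 0 ≤ pSX s x * enc x y := mul_nonneg (hpSX s x) (henc x y)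
  have hpw : 0 ≤ pSX s x * enc x y * ch y z := mul_nonneg hp (hch y z)
  by_cases hbad : Ds < ds s (gS z) ∨ Dx < dx x (gX z)
  · have hgood : ¬ (ds s (gS z) ≤ Ds ∧ dx x (gX z) ≤ Dx) := by
      rwa [not_and_or, not_le, not_le]
    rw [if_pos hbad, if_neg hgood]
    split_ifs <;> linarith
  · have hgood : ds s (gS z) ≤ Ds ∧ dx x (gX z) ≤ Dx := by
      rwa [not_or, not_lt, not_lt] at hbad
    rw [if_neg hbad, if_pos hgood]
    split_ifs with hlog
    · have := mul_le_mul_of_nonneg_left (le_exp_mul_of_log_div_le (hch y z) (hQ z) hlog) hp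
      linarith
    · have := mul_nonneg (Real.exp_pos γ).le (mul_nonneg hp (hQ z).le)
      linarith
end

section
/- Let 𝒴 and 𝒵 be finite sets, P_{Z|Y} a channel from 𝒴 to 𝒵, P_Y a pmf on 𝒴, and M a positive integer. Then there exist an encoder c : {1,…,M} → 𝒴 and a decoder g : 𝒵 → {1,…,M} such that the average error probability of the resulting channel code satisfies (1/M) Σ_{m=1}^{M} Σ_z P_{Z|Y}(z | c(m)) · 1[ g(z) ≠ m ] ≤ E[ exp( −| ı(Y;Z) − log M |⁺ ) ], where the expectation is with respect to (Y,Z) ~ P_Y P_{Z|Y}. -/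
open Finset Real

/-- Under i.i.d. sampling, the expectation of a product of functions of the single coordinates is
the product of the expectations. -/
lemma sum_prod_weight_mul_prod {ι Y : Type*} [Fintype ι] [DecidableEq ι] [Fintype Y]
    (p : Y → ℝ) (f : ι → Y → ℝ) :
    ∑ c : ι → Y, (∏ i, p (c i)) * ∏ i, f i (c i) = ∏ i, ∑ y, p y * f i y := by
  simp_rw [← Finset.prod_mul_distrib]
  rw [Finset.prod_univ_sum, Fintype.piFinset_univ]

lemma sum_prod_weight {ι Y : Type*} [Fintype ι] [DecidableEq ι] [Fintype Y]
    (p : Y → ℝ) (hp : ∑ y, p y = 1) : ∑ c : ι → Y, ∏ i, p (c i) = 1 := by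
  have h := sum_prod_weight_mul_prod (ι := ι) p (fun _ _ => 1)
  simpa [hp] using h

lemma sum_prod_weight_mul_apply {ι Y : Type*} [Fintype ι] [DecidableEq ι] [Fintype Y]
    (p : Y → ℝ) (hp : ∑ y, p y = 1) (m : ι) (k : Y → ℝ) :
    ∑ c : ι → Y, (∏ i, p (c i)) * k (c m) = ∑ y, p y * k y := by
  have h := sum_prod_weight_mul_prod p (fun i y => if i = m then k y else 1)
  rw [Fintype.prod_eq_single m (by intro i hi; simp [hi, hp])] at h
  simpa using h

lemma sum_prod_weight_mul_apply_mul_apply {ι Y : Type*} [Fintype ι] [DecidableEq ι] [Fintype Y]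
    (p : Y → ℝ) (hp : ∑ y, p y = 1) {m j : ι} (hmj : m ≠ j) (k l : Y → ℝ) :
    ∑ c : ι → Y, (∏ i, p (c i)) * (k (c m) * l (c j))
      = (∑ y, p y * k y) * ∑ y, p y * l y := by
  have h := sum_prod_weight_mul_prod p
    (fun i y => (if i = m then k y else 1) * (if i = j then l y else 1))
  rw [Fintype.prod_eq_mul m j hmj (by rintro i ⟨hi, hj⟩; simp [hi, hj, hp])] at h
  simp_rw [Finset.prod_mul_distrib (s := univ) (f := fun i => if i = m then _ else _)] at h
  simpa [hmj, hmj.symm] using h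

/-- If a weighted average is at most `b`, some value is at most `b`. -/
lemma exists_le_of_weighted_sum_le {α : Type*} [Fintype α] (w e : α → ℝ) (b : ℝ)
    (hw : ∀ a, 0 ≤ w a) (hw1 : ∑ a, w a = 1) (h : ∑ a, w a * e a ≤ b) : ∃ a, e a ≤ b := by
  by_contra! hlt
  obtain ⟨a, -, ha⟩ : ∃ a ∈ (univ : Finset α), w a ≠ 0 :=
    Finset.exists_ne_zero_of_sum_ne_zero (by rw [hw1]; exact one_ne_zero)
  have hb : ∑ a, w a * b < ∑ a, w a * e a :=
    Finset.sum_lt_sum (fun a _ => mul_le_mul_of_nonneg_left (hlt a).le (hw a))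
      ⟨a, mem_univ a, mul_lt_mul_of_pos_left (hlt a) ((hw a).lt_of_ne' ha)⟩
  rw [← Finset.sum_mul, hw1, one_mul] at hb
  linarith

/-- If `g` is a maximiser of the likelihoods `a`, the error term of `m` is bounded by `a m` and by
the sum of the competing likelihoods, so one may choose between the two bounds. -/
lemma likelihood_mul_error_le {ι : Type*} [Fintype ι] [DecidableEq ι]
    (a : ι → ℝ) (ha : ∀ i, 0 ≤ a i) (g m : ι) (hg : ∀ i, a i ≤ a g) (T : Prop) [Decidable T] :
    a m * (if g ≠ m then 1 else 0)
      ≤ (if T then a m else 0) + ∑ j ∈ univ.erase m, (if T then 0 else 1) * a j := by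
  by_cases hT : T
  · simp only [hT, if_true, zero_mul, Finset.sum_const_zero, add_zero]
    split_ifs <;> simp [ha m]
  · simp only [hT, if_false, one_mul, zero_add]
    split_ifs with hgm
    · rw [mul_one]
      exact (hg m).trans (Finset.single_le_sum (f := a) (fun i _ => ha i)
        (Finset.mem_erase.2 ⟨hgm, mem_univ g⟩))
    · rw [mul_zero]
      exact Finset.sum_nonneg fun i _ => ha i

/-- `w * exp (-|log (w / q) - log M|⁺)` dominates `w` when `w ≤ M q`, and `(M - 1) q` otherwise. -/
lemma threshold_le_mul_exp {w q M : ℝ} (hw : 0 < w) (hq : 0 < q) (hM : 0 < M) :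
    (if w ≤ M * q then w else 0) + (M - 1) * ((if w ≤ M * q then 0 else 1) * q)
      ≤ w * Real.exp (-(max (Real.log (w / q) - Real.log M) 0)) := by
  have hlog : Real.log (w / q) - Real.log M = Real.log (w / (M * q)) := by
    rw [← Real.log_div (by positivity) hM.ne', div_div, mul_comm q M]
  have hMq : 0 < M * q := mul_pos hM hq
  rw [hlog]
  split_ifs with h
  · rw [max_eq_right (Real.log_nonpos (by positivity) ((div_le_one hMq).2 h))]
    simp
  · rw [max_eq_left (Real.log_nonneg ((one_le_div hMq).2 (not_le.1 h).le)), Real.exp_neg,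
      Real.exp_log (by positivity), inv_div, mul_div_cancel₀ _ hw.ne']
    linarith



/-- One-shot random-coding bound: there exist an encoder `c : {1,…,M} → 𝒴` and a
decoder `g : 𝒵 → {1,…,M}` whose average error probability is at most
`E[exp (−|ı(Y;Z) − log M|⁺)]`, where `ı(y;z) = log (P_{Z|Y}(z|y) / P_Z(z))`. -/
theorem oneshot_random_coding_bound
    {Y Z : Type*} [Fintype Y] [Fintype Z]
    (pY : Y → ℝ) (pZY : Y → Z → ℝ)
    (hpY : ∀ y, 0 ≤ pY y) (hpY1 : ∑ y, pY y = 1)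
    (hpZY : ∀ y z, 0 ≤ pZY y z) (hpZY1 : ∀ y, ∑ z, pZY y z = 1)
    (M : ℕ) (hM : 0 < M) :
    ∃ (c : Fin M → Y) (g : Z → Fin M),
      (1 / (M : ℝ)) * ∑ m : Fin M, ∑ z, pZY (c m) z * (if g z ≠ m then 1 else 0)
        ≤ ∑ y, ∑ z, pY y * pZY y z *
            Real.exp (-(max (Real.log (pZY y z / ∑ y', pY y' * pZY y' z)
              - Real.log (M : ℝ)) 0)) := by
  classical
  have hM' : (0 : ℝ) < M := by exact_mod_cast hM
  have : Nonempty (Fin M) := ⟨⟨0, hM⟩⟩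
  set q : Z → ℝ := fun z => ∑ y', pY y' * pZY y' z with hq
  have hdec : ∀ (c : Fin M → Y) (z : Z), ∃ g, ∀ i, pZY (c i) z ≤ pZY (c g) z :=
    fun c z => Finite.exists_max fun i => pZY (c i) z
  choose g hg using hdec
  let A : Z → Y → ℝ := fun z y => if pZY y z ≤ M * q z then pZY y z else 0
  let K : Z → Y → ℝ := fun z y => if pZY y z ≤ M * q z then 0 else 1
  suffices h : ∃ c : Fin M → Y,
      (1 / (M : ℝ)) * ∑ m : Fin M, ∑ z,
        (A z (c m) + ∑ j ∈ univ.erase m, K z (c m) * pZY (c j) z)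
        ≤ ∑ y, ∑ z, pY y * pZY y z *
            Real.exp (-(max (Real.log (pZY y z / q z) - Real.log (M : ℝ)) 0)) by
    obtain ⟨c, hc⟩ := h
    refine ⟨c, g c, le_trans ?_ hc⟩
    gcongr with m _ z _
    exact likelihood_mul_error_le (fun i => pZY (c i) z) (fun i => hpZY _ _) _ m (hg c z) _
  refine exists_le_of_weighted_sum_le (fun c : Fin M → Y => ∏ i, pY (c i)) _ _
    (fun c => Finset.prod_nonneg fun i _ => hpY _) (sum_prod_weight pY hpY1) ?_
  have hexp : ∀ (m : Fin M) (z : Z),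
      ∑ c : Fin M → Y, (∏ i, pY (c i)) *
        (A z (c m) + ∑ j ∈ univ.erase m, K z (c m) * pZY (c j) z)
      = ∑ y, pY y * (A z y + (M - 1) * (K z y * q z)) := by
    intro m z
    simp_rw [mul_add, Finset.sum_add_distrib, Finset.mul_sum]
    rw [sum_prod_weight_mul_apply pY hpY1 m (A z), Finset.sum_comm,
      Finset.sum_congr rfl fun j hj => sum_prod_weight_mul_apply_mul_apply pY hpY1
        (Finset.ne_of_mem_erase hj).symm (K z) fun y => pZY y z]
    rw [Finset.sum_const, Finset.card_erase_of_mem (mem_univ m), Finset.card_univ,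
      Fintype.card_fin, nsmul_eq_mul, Nat.cast_pred hM, Finset.sum_mul, Finset.mul_sum]
    congr 1
    exact Finset.sum_congr rfl fun y _ => by ring
  have havg : ∑ c : Fin M → Y, (∏ i, pY (c i)) * ((1 / (M : ℝ)) * ∑ m : Fin M, ∑ z,
        (A z (c m) + ∑ j ∈ univ.erase m, K z (c m) * pZY (c j) z))
      = ∑ y, ∑ z, pY y * (A z y + (M - 1) * (K z y * q z)) := by
    calc _ = (1 / (M : ℝ)) * ∑ m : Fin M, ∑ z, ∑ c : Fin M → Y, (∏ i, pY (c i)) *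
        (A z (c m) + ∑ j ∈ univ.erase m, K z (c m) * pZY (c j) z) := by
          simp_rw [mul_left_comm _ (1 / (M : ℝ)), ← Finset.mul_sum univ _ (1 / (M : ℝ))]
          congr 1
          simp_rw [Finset.mul_sum univ]
          rw [Finset.sum_comm]
          exact Finset.sum_congr rfl fun m _ => Finset.sum_comm
      _ = _ := by
          simp_rw [hexp]
          rw [Finset.sum_const, Finset.card_univ, Fintype.card_fin, nsmul_eq_mul, ← mul_assoc,
            one_div_mul_cancel hM'.ne', one_mul, Finset.sum_comm]
  rw [havg]
  refine Finset.sum_le_sum fun y _ => Finset.sum_le_sum fun z _ => ?_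
  rw [mul_assoc]
  have hq0 : ∀ y', 0 ≤ pY y' * pZY y' z := fun y' => mul_nonneg (hpY y') (hpZY y' z)
  rcases (hpY y).eq_or_lt with hy | hy
  · simp [← hy]
  refine mul_le_mul_of_nonneg_left ?_ hy.le
  rcases (hpZY y z).eq_or_lt with hw | hw
  · have : 0 ≤ (M : ℝ) * q z := mul_nonneg hM'.le (Finset.sum_nonneg fun y' _ => hq0 y')
    simp [A, K, ← hw, this]
  · have hqz : 0 < q z := (mul_pos hy hw).trans_le
      (Finset.single_le_sum (f := fun y' => pY y' * pZY y' z) (fun y' _ => hq0 y') (mem_univ y))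
    exact threshold_le_mul_exp hw hqz hM'
end

section
/- Let 𝒴₁, 𝒴₂, 𝒵 be finite sets, let P_{Y₁Y₂} be a joint pmf on 𝒴₁×𝒴₂ and P_{Z|Y₁Y₂} a channel from 𝒴₁×𝒴₂ to 𝒵, and let M₂ be a positive integer. Then for every y₁ ∈ 𝒴₁ with P_{Y₁}(y₁) > 0 there exist an encoder c_{y₁} : {1,…,M₂} → 𝒴₂ and a decoder g_{y₁} : 𝒵 → {1,…,M₂} such that, averaging also over Y₁ ~ P_{Y₁}, the error probability satisfies E_{Y₁}[ (1/M₂) Σ_{m=1}^{M₂} Σ_z P_{Z|Y₁Y₂}(z | Y₁, c_{Y₁}(m)) · 1[ g_{Y₁}(z) ≠ m ] ] ≤ E[ exp( −| ı(Y₂;Z|Y₁) − log M₂ |⁺ ) ], where the expectation on the right is with respect to (Y₁,Y₂,Z) ~ P_{Y₁Y₂} P_{Z|Y₁Y₂}. -/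
open Finset Real

/-- Two-coordinate marginals of a product weight factorize. -/
theorem sum_prod_mul_apply_mul_apply {ι Y : Type*} [Fintype ι] [DecidableEq ι] [Fintype Y]
    (p f h : Y → ℝ) (hp : ∑ y, p y = 1) {m j : ι} (hmj : j ≠ m) :
    ∑ c : ι → Y, (∏ i, p (c i)) * (f (c m) * h (c j)) =
      (∑ y, p y * f y) * ∑ y, p y * h y := by
  have key := Fintype.prod_sum
    (fun (i : ι) (y : Y) => p y * ((if i = m then f y else 1) * (if i = j then h y else 1)))
  have hr (c : ι → Y) :
      ∏ i, p (c i) * ((if i = m then f (c i) else 1) * (if i = j then h (c i) else 1)) =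
        (∏ i, p (c i)) * (f (c m) * h (c j)) := by
    simp only [Finset.prod_mul_distrib, Finset.prod_ite_eq', Finset.mem_univ, if_true]
  have hl (i : ι) :
      ∑ y, p y * ((if i = m then f y else 1) * (if i = j then h y else 1)) =
        (if i = m then ∑ y, p y * f y else 1) * (if i = j then ∑ y, p y * h y else 1) := by
    by_cases h1 : i = m
    · subst h1
      simp [hmj.symm]
    · by_cases h2 : i = j <;> simp [h1, h2, hp, hmj]
  simp only [hr, hl] at key
  rw [← key]
  simp only [Finset.prod_mul_distrib, Finset.prod_ite_eq', Finset.mem_univ, if_true]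

/-- One-coordinate marginals of a product weight. -/
theorem sum_prod_mul_apply {ι Y : Type*} [Fintype ι] [DecidableEq ι] [Fintype Y]
    (p f : Y → ℝ) (hp : ∑ y, p y = 1) (m : ι) :
    ∑ c : ι → Y, (∏ i, p (c i)) * f (c m) = ∑ y, p y * f y := by
  have key := Fintype.prod_sum (fun (i : ι) (y : Y) => p y * (if i = m then f y else 1))
  have hr (c : ι → Y) : ∏ i, p (c i) * (if i = m then f (c i) else 1) =
      (∏ i, p (c i)) * f (c m) := by
    simp only [Finset.prod_mul_distrib, Finset.prod_ite_eq', Finset.mem_univ, if_true]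
  have hl (i : ι) : ∑ y, p y * (if i = m then f y else 1) =
      if i = m then ∑ y, p y * f y else 1 := by
    by_cases h1 : i = m <;> simp [h1, hp]
  simp only [hr, hl] at key
  rw [← key]
  simp

/-- Maximum-likelihood decoding: a message is misdecoded only if its likelihood is at most the
total likelihood of the competing messages. -/
theorem exists_decoder_le_min {ι Z : Type*} [Fintype ι] [DecidableEq ι] [Nonempty ι]
    (W : ι → Z → ℝ) (hW : ∀ m z, 0 ≤ W m z) :
    ∃ g : Z → ι, ∀ m z, W m z * (if g z ≠ m then 1 else 0) ≤
      min (W m z) (∑ j ∈ univ.erase m, W j z) := by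
  choose g hg using fun z => Finite.exists_max (fun m => W m z)
  refine ⟨g, fun m z => ?_⟩
  have hsum : 0 ≤ ∑ j ∈ univ.erase m, W j z := Finset.sum_nonneg fun j _ => hW j z
  by_cases h : g z = m
  · simp only [h, ne_eq, not_true_eq_false, if_false, mul_zero]
    exact le_min (hW m z) hsum
  · simp only [ne_eq, h, not_false_eq_true, if_true, mul_one]
    refine le_min le_rfl ((hg z m).trans ?_)
    exact Finset.single_le_sum (f := fun j => W j z) (fun j _ => hW j z) (by simp [h])

/-- Averaging over i.i.d. codewords: the competitors' total likelihood may be replaced by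
`card ι` times its mean. -/
theorem sum_prod_mul_min_le {ι Y : Type*} [Fintype ι] [DecidableEq ι] [Fintype Y]
    (p w : Y → ℝ) (hp0 : ∀ y, 0 ≤ p y) (hp : ∑ y, p y = 1) (hw : ∀ y, 0 ≤ w y) (m : ι) :
    ∑ c : ι → Y, (∏ i, p (c i)) * min (w (c m)) (∑ j ∈ univ.erase m, w (c j)) ≤
      ∑ y, p y * min (w y) (Fintype.card ι * ∑ y', p y' * w y') := by
  set q := ∑ y', p y' * w y'
  have hq0 : 0 ≤ q := Finset.sum_nonneg fun y _ => mul_nonneg (hp0 y) (hw y)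
  set T := (Fintype.card ι : ℝ) * q with hT
  set f : Y → ℝ := fun y => if w y ≤ T then w y else 0 with hf
  set e : Y → ℝ := fun y => if w y ≤ T then 0 else 1 with he
  have he0 (y : Y) : 0 ≤ e y := by simp only [he]; split_ifs <;> norm_num
  have hmin (y : Y) : min (w y) T = f y + e y * T := by
    simp only [hf, he]
    split_ifs with h
    · simp [h]
    · simp [(not_le.mp h).le]
  calc ∑ c : ι → Y, (∏ i, p (c i)) * min (w (c m)) (∑ j ∈ univ.erase m, w (c j))
      ≤ ∑ c : ι → Y, ((∏ i, p (c i)) * f (c m) +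
          ∑ j ∈ univ.erase m, (∏ i, p (c i)) * (e (c m) * w (c j))) := by
        refine Finset.sum_le_sum fun c _ => ?_
        rw [← Finset.mul_sum, ← Finset.mul_sum, ← mul_add]
        refine mul_le_mul_of_nonneg_left ?_ (Finset.prod_nonneg fun i _ => hp0 _)
        simp only [hf, he]
        split_ifs with h <;> simp
    _ = ∑ y, p y * f y + ∑ j ∈ univ.erase m, (∑ y, p y * e y) * q := by
        rw [Finset.sum_add_distrib, sum_prod_mul_apply p f hp m, Finset.sum_comm]
        congr 1
        exact Finset.sum_congr rfl fun j hj =>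
          sum_prod_mul_apply_mul_apply p e w hp (Finset.ne_of_mem_erase hj)
    _ ≤ ∑ y, p y * f y + ∑ j : ι, (∑ y, p y * e y) * q := by
        gcongr
        · intro j _ _
          exact mul_nonneg (Finset.sum_nonneg fun y _ => mul_nonneg (hp0 y) (he0 y)) hq0
        · exact Finset.erase_subset _ _
    _ = ∑ y, p y * min (w y) T := by
        simp only [hmin, mul_add, Finset.sum_add_distrib, ← mul_assoc, ← Finset.sum_mul]
        simp [hT]
        ring

/-- A function attains a value at most its weighted average. -/
theorem exists_le_sum_mul {α : Type*} [Fintype α] (w F : α → ℝ) (hw0 : ∀ a, 0 ≤ w a)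
    (hw : ∑ a, w a = 1) : ∃ a, F a ≤ ∑ b, w b * F b := by
  have : Nonempty α := by
    by_contra h
    rw [not_nonempty_iff] at h
    simp at hw
  obtain ⟨a, ha⟩ := Finite.exists_min F
  refine ⟨a, ?_⟩
  calc F a = ∑ b, w b * F a := by rw [← Finset.sum_mul, hw, one_mul]
    _ ≤ _ := Finset.sum_le_sum fun b _ => mul_le_mul_of_nonneg_left (ha b) (hw0 b)

/-- One-shot random-coding bound for a channel `W` and input pmf `p`. -/
theorem exists_code_error_le {Y Z : Type*} [Fintype Y] [Fintype Z]
    (p : Y → ℝ) (W : Y → Z → ℝ) (hp0 : ∀ y, 0 ≤ p y) (hp : ∑ y, p y = 1)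
    (hW : ∀ y z, 0 ≤ W y z) (M : ℕ) (hM : 0 < M) :
    ∃ (c : Fin M → Y) (g : Z → Fin M),
      (1 / (M : ℝ)) * ∑ m, ∑ z, W (c m) z * (if g z ≠ m then 1 else 0) ≤
        ∑ y, ∑ z, p y * min (W y z) (M * ∑ y', p y' * W y' z) := by
  have : Nonempty (Fin M) := ⟨⟨0, hM⟩⟩
  have hM' : (M : ℝ) ≠ 0 := by positivity
  obtain ⟨c, hc⟩ := exists_le_sum_mul (fun c : Fin M → Y => ∏ i, p (c i))
    (fun c => ∑ m, ∑ z, min (W (c m) z) (∑ j ∈ univ.erase m, W (c j) z))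
    (fun c => Finset.prod_nonneg fun i _ => hp0 _)
    (by
      have := Fintype.prod_sum (fun (_ : Fin M) (y : Y) => p y)
      simpa [hp] using this.symm)
  obtain ⟨g, hg⟩ := exists_decoder_le_min (fun m z => W (c m) z) (fun m z => hW _ _)
  refine ⟨c, g, ?_⟩
  set R := ∑ y, ∑ z, p y * min (W y z) (M * ∑ y', p y' * W y' z) with hR
  have hbound : ∑ m, ∑ z, W (c m) z * (if g z ≠ m then 1 else 0) ≤ M * R := by
    calc _ ≤ ∑ m, ∑ z, min (W (c m) z) (∑ j ∈ univ.erase m, W (c j) z) :=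
          Finset.sum_le_sum fun m _ => Finset.sum_le_sum fun z _ => hg m z
      _ ≤ _ := hc
      _ = ∑ m, ∑ z, ∑ c : Fin M → Y, (∏ i, p (c i)) *
            min (W (c m) z) (∑ j ∈ univ.erase m, W (c j) z) := by
          simp only [Finset.mul_sum]
          rw [Finset.sum_comm]
          exact Finset.sum_congr rfl fun m _ => Finset.sum_comm
      _ ≤ ∑ m : Fin M, ∑ z, ∑ y, p y * min (W y z) (M * ∑ y', p y' * W y' z) := by
          refine Finset.sum_le_sum fun m _ => Finset.sum_le_sum fun z _ => ?_
          simpa using sum_prod_mul_min_le p (fun y => W y z) hp0 hp (fun y => hW y z) m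
      _ = M * R := by
          rw [hR, Finset.sum_comm (s := (univ : Finset Y))]
          simp
  calc _ ≤ (1 / (M : ℝ)) * (M * R) := by gcongr
    _ = R := by field_simp

/-- `a · exp (−|log (a / q) − log M|⁺) = min a (M q)`. -/
theorem mul_exp_neg_max_log_sub_log {a q M : ℝ} (ha : 0 < a) (hq : 0 < q) (hM : 0 < M) :
    a * Real.exp (-(max (Real.log (a / q) - Real.log M) 0)) = min a (M * q) := by
  rw [← min_neg_neg, Real.exp_monotone.map_min, mul_min_of_nonneg _ _ ha.le, neg_sub,
    Real.exp_sub, Real.exp_log hM, Real.exp_log (div_pos ha hq), neg_zero, Real.exp_zero,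
    mul_one, min_comm]
  congr 1
  field_simp

/-- Conditional one-shot random-coding bound: there exist a family of encoders
`c y₁ : {1,…,M₂} → 𝒴₂` and decoders `g y₁ : 𝒵 → {1,…,M₂}` such that, averaging
over `Y₁ ~ P_{Y₁}`, the error probability is at most
`E[exp (−|ı(Y₂;Z|Y₁) − log M₂|⁺)]`, where
`ı(y₂;z|y₁) = log (P_{Z|Y₁Y₂}(z|y₁,y₂) / P_{Z|Y₁}(z|y₁))`. -/
theorem conditional_oneshot_random_coding_bound
    {Y₁ Y₂ Z : Type*} [Fintype Y₁] [Fintype Y₂] [Fintype Z]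
    (pY : Y₁ → Y₂ → ℝ) (ch : Y₁ → Y₂ → Z → ℝ)
    (hpY : ∀ y₁ y₂, 0 ≤ pY y₁ y₂) (hpY1 : ∑ y₁, ∑ y₂, pY y₁ y₂ = 1)
    (hch : ∀ y₁ y₂ z, 0 ≤ ch y₁ y₂ z) (hch1 : ∀ y₁ y₂, ∑ z, ch y₁ y₂ z = 1)
    (M₂ : ℕ) (hM₂ : 0 < M₂) :
    ∃ (c : Y₁ → Fin M₂ → Y₂) (g : Y₁ → Z → Fin M₂),
      ∑ y₁, (∑ y₂, pY y₁ y₂) *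
          ((1 / (M₂ : ℝ)) *
            ∑ m : Fin M₂, ∑ z, ch y₁ (c y₁ m) z * (if g y₁ z ≠ m then 1 else 0))
        ≤ ∑ y₁, ∑ y₂, ∑ z, pY y₁ y₂ * ch y₁ y₂ z *
            Real.exp (-(max (Real.log (ch y₁ y₂ z /
              ((∑ y₂', pY y₁ y₂' * ch y₁ y₂' z) / (∑ y₂', pY y₁ y₂')))
              - Real.log (M₂ : ℝ)) 0)) := by
  have hP0 (y₁ : Y₁) : 0 ≤ ∑ y₂, pY y₁ y₂ := Finset.sum_nonneg fun y₂ _ => hpY y₁ y₂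
  have hY₂ : Nonempty Y₂ := by
    by_contra h
    rw [not_nonempty_iff] at h
    simp at hpY1
  have hcode (y₁ : Y₁) : ∃ (c : Fin M₂ → Y₂) (g : Z → Fin M₂),
      (∑ y₂, pY y₁ y₂) *
          ((1 / (M₂ : ℝ)) * ∑ m : Fin M₂, ∑ z, ch y₁ (c m) z * (if g z ≠ m then 1 else 0))
        ≤ ∑ y₂, ∑ z, pY y₁ y₂ * ch y₁ y₂ z *
            Real.exp (-(max (Real.log (ch y₁ y₂ z /
              ((∑ y₂', pY y₁ y₂' * ch y₁ y₂' z) / (∑ y₂', pY y₁ y₂')))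
              - Real.log (M₂ : ℝ)) 0)) := by
    rcases (hP0 y₁).eq_or_lt with hP | hP
    · refine ⟨fun _ => hY₂.some, fun _ => ⟨0, hM₂⟩, ?_⟩
      rw [← hP, zero_mul]
      exact Finset.sum_nonneg fun y₂ _ => Finset.sum_nonneg fun z _ =>
        mul_nonneg (mul_nonneg (hpY _ _) (hch _ _ _)) (Real.exp_pos _).le
    · set P := ∑ y₂, pY y₁ y₂ with hPdef
      obtain ⟨c, g, h⟩ := exists_code_error_le (fun y₂ => pY y₁ y₂ / P) (ch y₁)
        (fun y₂ => div_nonneg (hpY _ _) hP.le)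
        (by rw [← Finset.sum_div, div_self hP.ne']) (hch y₁) M₂ hM₂
      refine ⟨c, g, (mul_le_mul_of_nonneg_left h hP.le).trans ?_⟩
      rw [Finset.mul_sum]
      refine Finset.sum_le_sum fun y₂ _ => ?_
      rw [Finset.mul_sum]
      refine Finset.sum_le_sum fun z _ => ?_
      have hq : ∑ y', pY y₁ y' / P * ch y₁ y' z = (∑ y', pY y₁ y' * ch y₁ y' z) / P := by
        rw [Finset.sum_div]
        exact Finset.sum_congr rfl fun y' _ => by ring
      rw [hq, ← mul_assoc, mul_div_cancel₀ _ hP.ne', mul_assoc]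
      rcases (hpY y₁ y₂).eq_or_lt with hp | hp
      · simp [← hp]
      refine mul_le_mul_of_nonneg_left ?_ hp.le
      rcases (hch y₁ y₂ z).eq_or_lt with hc | hc
      · simp [← hc]
      have hqpos : 0 < ∑ y', pY y₁ y' * ch y₁ y' z :=
        Finset.sum_pos' (fun y' _ => mul_nonneg (hpY _ _) (hch _ _ _))
          ⟨y₂, Finset.mem_univ _, mul_pos hp hc⟩
      rw [mul_exp_neg_max_log_sub_log hc (div_pos hqpos hP) (by positivity)]
  choose c g h using hcode
  exact ⟨c, g, Finset.sum_le_sum fun y₁ _ => h y₁⟩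
end
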